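/- For d = 9, the Poincaré series of the algebra of covariants of the binary 9-form satisfies P_9(z) = p_9(z)/((1 − z)(1 − z²)(1 − z⁴)(1 − z⁶)(1 − z⁸)(1 − z^{10})(1 − z^{12})(1 − z^{14})(1 − z^{16})), where p_9(z) = z^{63} + 3z^{61} + 10z^{60} + 23z^{59} + 49z^{58} + 93z^{57} + 172z^{56} + 289z^{55} + 457z^{54} + 701z^{53} + 1036z^{52} + 1477z^{51} + 2023z^{50} + 2720z^{49} + 3568z^{48} + 4573z^{47} + 5702z^{46} + 7013z^{45} + 8466z^{44} + 10043z^{43} + 11672z^{42} + 13400z^{41} + 15155z^{40} + 16880z^{39} + 18487z^{38} + 20013z^{37} + 21392z^{36} + 22539z^{35} + 23398z^{34} + 24013z^{33} + 24355z^{32} + 24355z^{31} + 24013z^{30} + 23398z^{29} + 22539z^{28} + 21392z^{27} + 20013z^{26} + 18487z^{25} + 16880z^{24} + 15155z^{23} + 13400z^{22} + 11672z^{21} + 10043z^{20} + 8466z^{19} + 7013z^{18} + 5702z^{17} + 4573z^{16} + 3568z^{15} + 2720z^{14} + 2023z^{13} + 1477z^{12} + 1036z^{11} + 701z^{10} + 457z^9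 + 289z^8 + 172z^7 + 93z^6 + 49z^5 + 23z^4 + 10z^3 + 3z^2 + 1; i.e. ∑_{n≥0} dim(S_n) z^n = p_9(z) · ((1 − z)(1 − z²)(1 − z⁴)(1 − z⁶)(1 − z⁸)(1 − z^{10})(1 − z^{12})(1 − z^{14})(1 − z^{16}))^{−1} in ℂ[[z]]. -/

import Mathlib

noncomputable section

/-- The derivation D₁ on ℂ[x_0,…,x_d] with D₁(x_0)=0 and D₁(x_i)=i·x_{i-1}
(for i = 0 the coefficient i vanishes, so the wrap-around in `Fin` is harmless). -/
def D1 (d : ℕ) :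
    Derivation ℂ (MvPolynomial (Fin (d + 1)) ℂ) (MvPolynomial (Fin (d + 1)) ℂ) :=
  MvPolynomial.mkDerivation ℂ (fun i => (i.val : ℂ) • MvPolynomial.X (i - 1))

/-- S_n: the space of homogeneous degree-n seminvariants of the binary d-form. -/
def Sn (d n : ℕ) : Submodule ℂ (MvPolynomial (Fin (d + 1)) ℂ) :=
  MvPolynomial.homogeneousSubmodule (Fin (d + 1)) ℂ n ⊓ LinearMap.ker (D1 d).toLinearMap

/-- The Poincaré series P_d(z) = ∑_{n≥0} dim(S_n) zⁿ of the algebra of covariants. -/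
def PSeries (d : ℕ) : PowerSeries ℂ :=
  PowerSeries.mk fun n => (Module.finrank ℂ (Sn d n) : ℂ)

section SlTwo

variable {M : Type*} [AddCommGroup M] [Module ℂ M] {V : ℤ → Submodule ℂ M}
  {e f : M →ₗ[ℂ] M}

theorem iterate_mem_of_raising (he : ∀ k, ∀ v ∈ V k, e v ∈ V (k + 2)) {k : ℤ} {v : M}
    (hv : v ∈ V k) (j : ℕ) : (e ^ j) v ∈ V (k + 2 * j) := by
  induction j with
  | zero => simpa using hv
  | succ j ih =>
    rw [pow_succ', Module.End.mul_apply]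
    convert he _ _ ih using 2
    push_cast
    ring

theorem iterate_mem_of_lowering (hf : ∀ k, ∀ v ∈ V k, f v ∈ V (k - 2)) {k : ℤ} {v : M}
    (hv : v ∈ V k) (j : ℕ) : (f ^ j) v ∈ V (k - 2 * j) := by
  induction j with
  | zero => simpa using hv
  | succ j ih =>
    rw [pow_succ', Module.End.mul_apply]
    convert hf _ _ ih using 2
    push_cast
    ring

theorem iterate_raising_lowering (he : ∀ k, ∀ v ∈ V k, e v ∈ V (k + 2))
    (hef : ∀ k, ∀ v ∈ V k, e (f v) = f (e v) + (k : ℂ) • v) {k : ℤ} {v : M}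
    (hv : v ∈ V k) (j : ℕ) :
    (e ^ (j + 1)) (f v) = f ((e ^ (j + 1)) v) + ((j + 1) * (k + j) : ℂ) • (e ^ j) v := by
  induction j with
  | zero => simpa using hef k v hv
  | succ j ih =>
    rw [pow_succ', Module.End.mul_apply, ih, map_add, map_smul,
      hef _ _ (iterate_mem_of_raising he hv (j + 1)), ← Module.End.mul_apply e, ← pow_succ',
      ← Module.End.mul_apply e, ← pow_succ', add_assoc, ← add_smul]
    congr 2
    push_cast
    ring

/-- In a weight space of positive weight, the raising operator of an `sl₂`-action is onto. -/
theorem exists_raising_eq (he : ∀ k, ∀ v ∈ V k, e v ∈ V (k + 2))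
    (hf : ∀ k, ∀ v ∈ V k, f v ∈ V (k - 2))
    (hef : ∀ k, ∀ v ∈ V k, e (f v) = f (e v) + (k : ℂ) • v) {k : ℤ} (hk : 0 < k) (j : ℕ)
    {v : M} (hv : v ∈ V k) (hj : (e ^ j) v = 0) : ∃ u ∈ V (k - 2), e u = v := by
  induction j generalizing v with
  | zero => exact ⟨0, zero_mem _, by simpa using hj.symm⟩
  | succ j ih =>
    set c : ℂ := (j + 1) * (k + j) with hc
    have hc0 : c ≠ 0 := by
      have : ((j : ℤ) + 1) * (k + j) ≠ 0 := by positivity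
      rw [hc]
      exact_mod_cast this
    have hefv : e (f v) ∈ V k := by
      simpa using he _ _ (hf k v hv)
    have hw : (e ^ j) (e (f v) - c • v) = 0 := by
      rw [map_sub, map_smul, ← Module.End.mul_apply, ← pow_succ,
        iterate_raising_lowering he hef hv, hj, map_zero, zero_add, sub_self]
    obtain ⟨u, hu, hu'⟩ := ih (sub_mem hefv (Submodule.smul_mem _ c hv)) hw
    refine ⟨c⁻¹ • (f v - u), Submodule.smul_mem _ _ (sub_mem (hf k v hv) hu), ?_⟩
    rw [map_smul, map_sub, hu', sub_sub_cancel, inv_smul_smul₀ hc0]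

/-- In a weight space of negative weight, the raising operator of an `sl₂`-action is
injective. -/
theorem eq_zero_of_raising_eq_zero (hf : ∀ k, ∀ v ∈ V k, f v ∈ V (k - 2))
    (hef : ∀ k, ∀ v ∈ V k, e (f v) = f (e v) + (k : ℂ) • v) {k : ℤ} (hk : k < 0) (j : ℕ)
    {v : M} (hv : v ∈ V k) (hev : e v = 0) (hj : (f ^ j) v = 0) : v = 0 := by
  have key (j : ℕ) : e ((f ^ (j + 1)) v) = ((j + 1) * (k - j) : ℂ) • (f ^ j) v := by
    induction j with
    | zero => simpa [hev] using hef k v hv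
    | succ j ih =>
      rw [pow_succ', Module.End.mul_apply, hef _ _ (iterate_mem_of_lowering hf hv (j + 1)), ih,
        map_smul, ← Module.End.mul_apply, ← pow_succ', ← add_smul]
      congr 1
      push_cast
      ring
  induction j with
  | zero => simpa using hj
  | succ j ih =>
    have h := key j
    rw [hj, map_zero, eq_comm, smul_eq_zero] at h
    refine ih (h.resolve_left ?_)
    have : ((j : ℤ) + 1) * (k - j) ≠ 0 := mul_ne_zero (by positivity) (by omega)
    exact_mod_cast this

end SlTwo

section WeightedHomogeneous

open MvPolynomial

variable {R σ N : Type*} [CommRing R] [AddCommGroup N] {ω : σ → N}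

theorem derivation_apply_monomial (D : Derivation R (MvPolynomial σ R) (MvPolynomial σ R))
    (s : σ →₀ ℕ) (r : R) :
    D (monomial s r) =
      r • s.sum fun i k => monomial (s - Finsupp.single i 1) (k : R) * D (X i) := by
  have : D = mkDerivation R fun i => D (X i) := derivation_ext fun i => by simp
  conv_lhs => rw [this]
  rw [mkDerivation_monomial]
  simp only [smul_eq_mul]

theorem weight_sub_single_add {s : σ →₀ ℕ} {i : σ} (hi : i ∈ s.support) :
    Finsupp.weight ω (s - Finsupp.single i 1) + ω i = Finsupp.weight ω s := by
  have h : Finsupp.single i 1 ≤ s := by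
    rw [Finsupp.single_le_iff]
    exact Nat.one_le_iff_ne_zero.mpr (Finsupp.mem_support_iff.mp hi)
  conv_rhs => rw [← tsub_add_cancel_of_le h, map_add, Finsupp.weight_single, one_smul]

theorem isWeightedHomogeneous_derivation_monomial
    {D : Derivation R (MvPolynomial σ R) (MvPolynomial σ R)} {δ : N}
    (hD : ∀ i, IsWeightedHomogeneous ω (D (X i)) (ω i + δ)) (s : σ →₀ ℕ) (r : R) :
    IsWeightedHomogeneous ω (D (monomial s r)) (Finsupp.weight ω s + δ) := by
  rw [derivation_apply_monomial]
  refine Submodule.smul_mem (weightedHomogeneousSubmodule R ω _) r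
    (Submodule.sum_mem _ fun i hi => ?_)
  rw [mem_weightedHomogeneousSubmodule, ← weight_sub_single_add hi, add_assoc]
  exact (isWeightedHomogeneous_monomial ω _ _ rfl).mul (hD i)

theorem weightedHomogeneousComponent_derivation
    {D : Derivation R (MvPolynomial σ R) (MvPolynomial σ R)} {δ : N}
    (hD : ∀ i, IsWeightedHomogeneous ω (D (X i)) (ω i + δ)) (m : N) (p : MvPolynomial σ R) :
    weightedHomogeneousComponent ω (m + δ) (D p) = D (weightedHomogeneousComponent ω m p) := by
  classical
  induction p using MvPolynomial.induction_on' with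
  | monomial s r =>
    have hs := isWeightedHomogeneous_derivation_monomial hD s r
    have hm := isWeightedHomogeneous_monomial ω s r rfl
    by_cases h : m = Finsupp.weight ω s
    · rw [h, hs.weightedHomogeneousComponent_same, hm.weightedHomogeneousComponent_same]
    · rw [hs.weightedHomogeneousComponent_ne _ (by simpa using h),
        hm.weightedHomogeneousComponent_ne _ h, map_zero]
  | add p q hp hq => simp only [map_add, hp, hq]

theorem IsWeightedHomogeneous.derivation
    {D : Derivation R (MvPolynomial σ R) (MvPolynomial σ R)} {δ : N}
    (hD : ∀ i, IsWeightedHomogeneous ω (D (X i)) (ω i + δ)) {m : N} {p : MvPolynomial σ R}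
    (hp : IsWeightedHomogeneous ω p m) : IsWeightedHomogeneous ω (D p) (m + δ) := by
  rw [← hp.weightedHomogeneousComponent_same, ← weightedHomogeneousComponent_derivation hD]
  exact weightedHomogeneousComponent_isWeightedHomogeneous _ _

/-- A derivation that scales the variables additively in their weights scales weighted
homogeneous polynomials by their weight. -/
theorem IsWeightedHomogeneous.derivation_eq_smul
    {D : Derivation R (MvPolynomial σ R) (MvPolynomial σ R)} (φ : N →+ R)
    (hD : ∀ i, D (X i) = φ (ω i) • X i) {m : N} {p : MvPolynomial σ R}
    (hp : IsWeightedHomogeneous ω p m) : D p = φ m • p := by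
  have hmon (s : σ →₀ ℕ) (r : R) :
      D (monomial s r) = φ (Finsupp.weight ω s) • monomial s r := by
    have hterm (i : σ) (hi : i ∈ s.support) :
        monomial (s - Finsupp.single i 1) ((s i : ℕ) : R) * D (X i) =
          φ (s i • ω i) • monomial s (1 : R) := by
      have h : Finsupp.single i 1 ≤ s := by
        rw [Finsupp.single_le_iff]
        exact Nat.one_le_iff_ne_zero.mpr (Finsupp.mem_support_iff.mp hi)
      rw [hD, X, mul_smul_comm, monomial_mul, tsub_add_cancel_of_le h, smul_monomial,
        smul_monomial, map_nsmul]
      congr 1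
      simp [mul_comm]
    rw [derivation_apply_monomial, Finsupp.sum, Finset.sum_congr rfl hterm, ← Finset.sum_smul,
      ← map_sum, Finsupp.weight_apply, Finsupp.sum, smul_comm, smul_monomial, smul_eq_mul, mul_one]
  rw [p.as_sum, map_sum, Finset.smul_sum]
  refine Finset.sum_congr rfl fun s hs => ?_
  rw [hmon, hp (mem_support_iff.mp hs)]

end WeightedHomogeneous

section Seminvariants

open MvPolynomial

/-- The derivation `x_i ↦ (d - i) x_{i+1}`, opposite to `D1`. -/
def D2 (d : ℕ) :
    Derivation ℂ (MvPolynomial (Fin (d + 1)) ℂ) (MvPolynomial (Fin (d + 1)) ℂ) :=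
  mkDerivation ℂ (fun i => ((d : ℂ) - i.val) • X (i + 1))

/-- The bidegree of `x_i`: its degree and its `sl₂`-weight. -/
def biweight (d : ℕ) (i : Fin (d + 1)) : ℤ × ℤ := (1, 2 * (i : ℤ) - d)

theorem weight_biweight (d : ℕ) (a : Fin (d + 1) →₀ ℕ) :
    Finsupp.weight (biweight d) a =
      (((∑ i, a i : ℕ) : ℤ), ∑ i : Fin (d + 1), (2 * (i : ℤ) - d) * a i) := by
  rw [Finsupp.weight_apply, Finsupp.sum_fintype _ _ (by simp)]
  ext <;> simp [biweight, Prod.fst_sum, Prod.snd_sum, mul_comm]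

theorem isWeightedHomogeneous_D1_X (d : ℕ) (i : Fin (d + 1)) :
    IsWeightedHomogeneous (biweight d) (D1 d (X i)) (biweight d i + (0, -2)) := by
  rw [D1, mkDerivation_X]
  by_cases hi : i = 0
  · simpa [hi] using isWeightedHomogeneous_zero ℂ (biweight d) _
  · refine Submodule.smul_mem (weightedHomogeneousSubmodule ℂ (biweight d) _) _ ?_
    have : biweight d i + (0, -2) = biweight d (i - 1) := by
      have h1 : ((i - 1 : Fin (d + 1)) : ℕ) = i - 1 := by rw [Fin.val_sub_one_of_ne_zero hi]
      have h2 : (i : ℕ) ≠ 0 := fun h => hi (Fin.ext h)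
      simp only [biweight, h1, Prod.mk_add_mk, add_zero, Prod.mk.injEq, true_and]
      omega
    rw [this]
    exact isWeightedHomogeneous_X ℂ _ _

theorem isWeightedHomogeneous_D2_X (d : ℕ) (i : Fin (d + 1)) :
    IsWeightedHomogeneous (biweight d) (D2 d (X i)) (biweight d i + (0, 2)) := by
  rw [D2, mkDerivation_X]
  by_cases hi : i = Fin.last d
  · simpa [hi] using isWeightedHomogeneous_zero ℂ (biweight d) _
  · refine Submodule.smul_mem (weightedHomogeneousSubmodule ℂ (biweight d) _) _ ?_
    have : biweight d i + (0, 2) = biweight d (i + 1) := by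
      have h1 : ((i + 1 : Fin (d + 1)) : ℕ) = i + 1 := by rw [Fin.val_add_one, if_neg hi]
      simp only [biweight, h1, Prod.mk_add_mk, add_zero, Prod.mk.injEq, true_and]
      push_cast
      ring
    rw [this]
    exact isWeightedHomogeneous_X ℂ _ _

theorem lie_D1_D2_X (d : ℕ) (i : Fin (d + 1)) :
    ⁅D1 d, D2 d⁆ (X i) = ((d : ℂ) - 2 * i.val) • X i := by
  have h12 : D1 d (D2 d (X i)) = (((d : ℂ) - i.val) * (i.val + 1)) • X i := by
    rw [D2, mkDerivation_X, Derivation.map_smul, D1, mkDerivation_X, smul_smul, add_sub_cancel_right]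
    by_cases hi : i = Fin.last d
    · simp [hi]
    · rw [Fin.val_add_one, if_neg hi]
      push_cast
      rfl
  have h21 : D2 d (D1 d (X i)) = ((i.val : ℂ) * (d - i.val + 1)) • X i := by
    rw [D1, mkDerivation_X, Derivation.map_smul, D2, mkDerivation_X, smul_smul, sub_add_cancel]
    by_cases hi : i = 0
    · simp [hi]
    · have h2 : (i : ℕ) ≠ 0 := fun h => hi (Fin.ext h)
      rw [Fin.val_sub_one_of_ne_zero hi, Nat.cast_sub (by omega)]
      congr 2
      push_cast
      ring
  rw [Derivation.commutator_apply, h12, h21, ← sub_smul]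
  congr 1
  ring

/-- The polynomials of degree `n` and weight `-k`. -/
def weightSpace (d n : ℕ) (k : ℤ) : Submodule ℂ (MvPolynomial (Fin (d + 1)) ℂ) :=
  weightedHomogeneousSubmodule ℂ (biweight d) ((n : ℤ), -k)

theorem D1_mem_weightSpace (d n : ℕ) (k : ℤ) :
    ∀ v ∈ weightSpace d n k, (D1 d).toLinearMap v ∈ weightSpace d n (k + 2) := by
  intro v hv
  have h := IsWeightedHomogeneous.derivation (isWeightedHomogeneous_D1_X d) hv
  rw [Prod.mk_add_mk, add_zero, ← neg_add] at h
  exact h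

theorem D2_mem_weightSpace (d n : ℕ) (k : ℤ) :
    ∀ v ∈ weightSpace d n k, (D2 d).toLinearMap v ∈ weightSpace d n (k - 2) := by
  intro v hv
  have h := IsWeightedHomogeneous.derivation (isWeightedHomogeneous_D2_X d) hv
  rw [Prod.mk_add_mk, add_zero, neg_add_eq_sub, ← neg_sub] at h
  exact h

theorem D1_D2_apply (d n : ℕ) (k : ℤ) :
    ∀ v ∈ weightSpace d n k, (D1 d).toLinearMap ((D2 d).toLinearMap v) =
      (D2 d).toLinearMap ((D1 d).toLinearMap v) + (k : ℂ) • v := by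
  intro v hv
  have h := IsWeightedHomogeneous.derivation_eq_smul (D := ⁅D1 d, D2 d⁆)
    (-((Int.castAddHom ℂ).comp (AddMonoidHom.snd ℤ ℤ)))
    (fun i => by rw [lie_D1_D2_X]; simp [biweight]) hv
  rw [Derivation.commutator_apply, sub_eq_iff_eq_add'] at h
  simpa using h

theorem eq_zero_of_mem_weightSpace {d n : ℕ} {k : ℤ} (hk : (d * n : ℤ) < |k|)
    {v : MvPolynomial (Fin (d + 1)) ℂ} (hv : v ∈ weightSpace d n k) : v = 0 := by
  refine IsWeightedHomogeneous.eq_zero_of_no_monomials hv fun a ha => hk.not_ge ?_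
  rw [weight_biweight, Prod.mk.injEq] at ha
  obtain ⟨h1, h2⟩ := ha
  rw [← abs_neg, ← h2, ← h1, Nat.cast_sum, Finset.mul_sum]
  refine (Finset.abs_sum_le_sum_abs _ _).trans (Finset.sum_le_sum fun i _ => ?_)
  rw [abs_mul, Nat.abs_cast]
  refine mul_le_mul_of_nonneg_right ?_ (by positivity)
  rw [abs_le]
  omega

theorem iterate_D1_eq_zero {d n : ℕ} {k : ℤ} {v : MvPolynomial (Fin (d + 1)) ℂ}
    (hv : v ∈ weightSpace d n k) : ∃ j, ((D1 d).toLinearMap ^ j) v = 0 := by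
  refine ⟨d * n + k.natAbs + 1, eq_zero_of_mem_weightSpace ?_
    (iterate_mem_of_raising (D1_mem_weightSpace d n) hv _)⟩
  push_cast
  have : (0 : ℤ) ≤ d * n := by positivity
  linarith [neg_abs_le k, abs_nonneg k,
    le_abs_self (k + 2 * ((d : ℤ) * n + |k| + 1))]

theorem iterate_D2_eq_zero {d n : ℕ} {k : ℤ} {v : MvPolynomial (Fin (d + 1)) ℂ}
    (hv : v ∈ weightSpace d n k) : ∃ j, ((D2 d).toLinearMap ^ j) v = 0 := by
  refine ⟨d * n + k.natAbs + 1, eq_zero_of_mem_weightSpace ?_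
    (iterate_mem_of_lowering (D2_mem_weightSpace d n) hv _)⟩
  push_cast
  have : (0 : ℤ) ≤ d * n := by positivity
  linarith [le_abs_self k, abs_nonneg k,
    neg_le_abs (k - 2 * ((d : ℤ) * n + |k| + 1))]

/-- The exponents of the monomials of degree `n` whose weight is at most `k`. -/
def lowExponents (d n : ℕ) (k : ℤ) : Finset (Fin (d + 1) →₀ ℕ) :=
  (Finset.univ.finsuppAntidiag n).filter
    (fun a => ∑ i : Fin (d + 1), (2 * (i : ℤ) - d) * a i ≤ k)

theorem mem_lowExponents {d n : ℕ} {k : ℤ} {a : Fin (d + 1) →₀ ℕ} :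
    a ∈ lowExponents d n k ↔ ∃ l ≤ k, Finsupp.weight (biweight d) a = ((n : ℤ), l) := by
  simp [lowExponents, weight_biweight, -Nat.cast_sum, and_comm]

theorem weightSpace_le_restrictSupport {d n : ℕ} {k l : ℤ} (h : -l ≤ k) :
    weightSpace d n l ≤ restrictSupport ℂ (lowExponents d n k : Set (Fin (d + 1) →₀ ℕ)) := by
  intro v hv
  rw [mem_restrictSupport_iff]
  intro a ha
  exact mem_lowExponents.mpr ⟨-l, h, hv (mem_support_iff.mp ha)⟩

theorem map_D1_restrictSupport (d n : ℕ) :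
    (restrictSupport ℂ (lowExponents d n 0 : Set (Fin (d + 1) →₀ ℕ))).map (D1 d).toLinearMap =
      restrictSupport ℂ (lowExponents d n (-2) : Set (Fin (d + 1) →₀ ℕ)) := by
  apply le_antisymm
  · rw [restrictSupport_eq_span, Submodule.map_span_le]
    rintro _ ⟨a, ha, rfl⟩
    obtain ⟨l, hl, hal⟩ := mem_lowExponents.mp ha
    refine weightSpace_le_restrictSupport (l := -l + 2) (by omega)
      (D1_mem_weightSpace d n (-l) _ ?_)
    exact isWeightedHomogeneous_monomial _ _ _ (by rw [hal, neg_neg])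
  · rw [restrictSupport_eq_span ℂ (lowExponents d n (-2) : Set (Fin (d + 1) →₀ ℕ)), Submodule.span_le]
    rintro _ ⟨a, ha, rfl⟩
    obtain ⟨l, hl, hal⟩ := mem_lowExponents.mp ha
    have hv : monomial a (1 : ℂ) ∈ weightSpace d n (-l) :=
      isWeightedHomogeneous_monomial _ _ _ (by rw [hal, neg_neg])
    obtain ⟨j, hj⟩ := iterate_D1_eq_zero hv
    obtain ⟨u, hu, huv⟩ := exists_raising_eq (D1_mem_weightSpace d n) (D2_mem_weightSpace d n)
      (D1_D2_apply d n) (by omega) j hv hj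
    exact ⟨u, weightSpace_le_restrictSupport (by omega) hu, huv⟩

theorem restrictSupport_inf_ker_D1 (d n : ℕ) :
    restrictSupport ℂ (lowExponents d n 0 : Set (Fin (d + 1) →₀ ℕ)) ⊓
      LinearMap.ker (D1 d).toLinearMap = Sn d n := by
  ext v
  simp only [Sn, Submodule.mem_inf, and_congr_left_iff]
  intro hv
  constructor
  · intro h a ha
    obtain ⟨l, -, hal⟩ := mem_lowExponents.mp (h (mem_support_iff.mpr ha))
    rw [weight_biweight, Prod.mk.injEq] at hal
    rw [Finsupp.weight_apply, Finsupp.sum_fintype _ _ (by simp)]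
    simpa using (by exact_mod_cast hal.1 : ∑ i, a i = n)
  · intro h
    rw [mem_restrictSupport_iff]
    intro a ha
    have han : ∑ i, a i = n := by
      have := h (mem_support_iff.mp ha)
      rw [Finsupp.weight_apply, Finsupp.sum_fintype _ _ (by simp)] at this
      simpa using this
    set l := ∑ i : Fin (d + 1), (2 * (i : ℤ) - d) * a i with hl
    have hal : Finsupp.weight (biweight d) a = ((n : ℤ), l) := by
      rw [weight_biweight, han]
    refine mem_lowExponents.mpr ⟨l, ?_, hal⟩
    by_contra! hpos
    have hmem : weightedHomogeneousComponent (biweight d) ((n : ℤ), l) v ∈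
        weightSpace d n (-l) := by
      rw [weightSpace, neg_neg]
      exact weightedHomogeneousComponent_mem _ _ _
    have hker : (D1 d).toLinearMap
        (weightedHomogeneousComponent (biweight d) ((n : ℤ), l) v) = 0 := by
      change D1 d _ = 0
      rw [← weightedHomogeneousComponent_derivation (isWeightedHomogeneous_D1_X d)]
      have : D1 d v = 0 := hv
      rw [this, map_zero]
    obtain ⟨j, hj⟩ := iterate_D2_eq_zero hmem
    have hzero := eq_zero_of_raising_eq_zero (D2_mem_weightSpace d n) (D1_D2_apply d n)
      (by omega) j hmem hker hj
    have hcoeff := congrArg (coeff a) hzero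
    rw [coeff_weightedHomogeneousComponent, if_pos hal, coeff_zero] at hcoeff
    exact mem_support_iff.mp ha hcoeff

theorem finrank_restrictSupport {σ : Type*} (s : Finset (σ →₀ ℕ)) :
    Module.finrank ℂ (restrictSupport ℂ (s : Set (σ →₀ ℕ))) = s.card := by
  rw [Module.finrank_eq_card_basis (basisRestrictSupport ℂ (s : Set (σ →₀ ℕ)))]
  simp

theorem finrank_Sn_add (d n : ℕ) :
    Module.finrank ℂ (Sn d n) + (lowExponents d n (-2)).card = (lowExponents d n 0).card := by
  set U := restrictSupport ℂ (lowExponents d n 0 : Set (Fin (d + 1) →₀ ℕ)) with hU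
  have : Module.Finite ℂ U := Module.Finite.of_basis (basisRestrictSupport ℂ _)
  have h := LinearMap.finrank_range_add_finrank_ker ((D1 d).toLinearMap.domRestrict U)
  rw [LinearMap.range_domRestrict, map_D1_restrictSupport, finrank_restrictSupport,
    LinearMap.ker_domRestrict, ← Submodule.finrank_map_subtype_eq, Submodule.map_comap_subtype,
    restrictSupport_inf_ker_D1, finrank_restrictSupport] at h
  omega

theorem finrank_Sn (d n : ℕ) :
    Module.finrank ℂ (Sn d n) =
      ((Finset.univ.finsuppAntidiag n).filter
        (fun a : Fin (d + 1) →₀ ℕ => ∑ i : Fin (d + 1), (2 * (i : ℤ) - d) * a i = 0)).card +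
      ((Finset.univ.finsuppAntidiag n).filter
        (fun a : Fin (d + 1) →₀ ℕ => ∑ i : Fin (d + 1), (2 * (i : ℤ) - d) * a i = -1)).card := by
  have h := finrank_Sn_add d n
  simp only [lowExponents] at h
  have hsplit (k : ℤ) (f : (Fin (d + 1) →₀ ℕ) → ℤ) :
      ((Finset.univ.finsuppAntidiag n).filter (fun a => f a ≤ k)).card =
        ((Finset.univ.finsuppAntidiag n).filter (fun a => f a = k)).card +
          ((Finset.univ.finsuppAntidiag n).filter (fun a => f a ≤ k - 1)).card := by
    rw [← Finset.card_union_of_disjoint, ← Finset.filter_or]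
    · congr 1
      exact Finset.filter_congr fun a _ => by omega
    · exact Finset.disjoint_filter.mpr fun a _ h => by omega
  rw [hsplit 0, hsplit (0 - 1)] at h
  norm_num at h ⊢
  omega

end Seminvariants

/-- The value at `x` of the polynomial with coefficient list `l`, lowest degree first. -/
def evalCoeffs {R : Type*} [CommRing R] (x : R) (l : List ℤ) : R :=
  l.foldr (fun (c : ℤ) acc => (c : R) + x * acc) (0 : R)

/-- The value at `(x, y)` of the bivariate polynomial whose coefficient of `y ^ k` is the
polynomial in `x` with the `k`-th coefficient list. -/
def evalCoeffs₂ {R : Type*} [CommRing R] (x y : R) (l : List (List ℤ)) : R :=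
  l.foldr (fun c acc => evalCoeffs x c + y * acc) (0 : R)

/-- Coefficientwise difference of two polynomials. -/
def subCoeffs : List ℤ → List ℤ → List ℤ
  | [], m => m.map Neg.neg
  | a :: l, [] => a :: l
  | a :: l, b :: m => (a - b) :: subCoeffs l m

/-- Coefficientwise difference of two bivariate polynomials. -/
def subCoeffs₂ : List (List ℤ) → List (List ℤ) → List (List ℤ)
  | [], m => m.map (List.map Neg.neg)
  | a :: l, [] => a :: l
  | a :: l, b :: m => subCoeffs a b :: subCoeffs₂ l m

/-- Multiplication of a polynomial by `1 - x ^ e`. -/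
def mulOneSubPow (e : ℕ) (l : List ℤ) : List ℤ :=
  subCoeffs l (List.replicate e 0 ++ l)

/-- Multiplication of a bivariate polynomial by `1 - x * y ^ p`. -/
def mulOneSub (p : ℕ) (l : List (List ℤ)) : List (List ℤ) :=
  subCoeffs₂ l (List.replicate p [] ++ l.map (List.cons 0))

/-- Multiplication of a bivariate polynomial by `y ^ q - x`. -/
def mulPowSub (q : ℕ) (l : List (List ℤ)) : List (List ℤ) :=
  subCoeffs₂ (List.replicate q [] ++ l) (l.map (List.cons 0))

/-- The polynomial in `x, y` whose coefficients are the partial fraction numerator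
(with respect to `y`) over the denominator `∏ (1 - x * y ^ p)`, for `p = 1, 3, 5, 7, 9`. -/
def posNumerator : List (List ℤ) :=
  [[1, 0, 3, 0, 33, 0, 142, 0, 461, 0, 1158, 0, 2513, 0, 4743, 0, 8141, 0, 12715, 0, 18509, 0,
    25072, 0, 32035, 0, 38500, 0, 43931, 0, 47411, 0, 48710, 0, 47411, 0, 43931, 0, 38500, 0,
    32035, 0, 25072, 0, 18509, 0, 12715, 0, 8141, 0, 4743, 0, 2513, 0, 1158, 0, 461, 0, 142, 0,
    33, 0, 3, 0, 1],
  [0, 0, 0, 10, 0, 39, 0, 123, 0, 285, 0, 579, 0, 987, 0, 1545, 0, 2134, 0, 2764, 0, 3206, 0,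
    3483, 0, 3332, 0, 2905, 0, 2006, 0, 957, 0, -342, 0, -1474, 0, -2526, 0, -3133, 0, -3480, 0,
    -3357, 0, -3030, 0, -2440, 0, -1853, 0, -1243, 0, -776, 0, -412, 0, -196, 0, -70, 0, -20, 0,
    -2, 0, -1],
  [0, 0, 4, 0, 18, 0, 73, 0, 188, 0, 420, 0, 759, 0, 1261, 0, 1821, 0, 2470, 0, 2990, 0, 3402, 0,
    3428, 0, 3194, 0, 2471, 0, 1542, 0, 286, 0, -889, 0, -2061, 0, -2844, 0, -3384, 0, -3438, 0,
    -3246, 0, -2734, 0, -2166, 0, -1527, 0, -1004, 0, -571, 0, -293, 0, -120, 0, -41, 0, -8, 0,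
    -1],
  [0, 0, 0, 5, 0, 7, 0, -24, 0, -171, 0, -591, 0, -1514, 0, -3223, 0, -5984, 0, -9984, 0, -15265,
    0, -21636, 0, -28648, 0, -35645, 0, -41859, 0, -46509, 0, -48983, 0, -48942, 0, -46391, 0,
    -41691, 0, -35465, 0, -28476, 0, -21502, 0, -15194, 0, -9969, 0, -6009, 0, -3276, 0, -1581, 0,
    -651, 0, -216, 0, -51, 0, -7, 0, -1],
  [0, 0, 3, 0, 10, 0, 29, 0, 70, 0, 122, 0, 193, 0, 248, 0, 299, 0, 302, 0, 263, 0, 149, 0, 1, 0,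
    -187, 0, -369, 0, -518, 0, -602, 0, -603, 0, -522, 0, -375, 0, -200, 0, -5, 0, 147, 0, 256, 0,
    299, 0, 302, 0, 253, 0, 193, 0, 125, 0, 72, 0, 32, 0, 11, 0, 1, 0, 1],
  [0, 0, 0, 1, 0, -14, 0, -95, 0, -367, 0, -1003, 0, -2293, 0, -4467, 0, -7834, 0, -12424, 0,
    -18296, 0, -24988, 0, -32122, 0, -38778, 0, -44380, 0, -47981, 0, -49324, 0, -47984, 0,
    -44391, 0, -38793, 0, -32134, 0, -24996, 0, -18303, 0, -12430, 0, -7833, 0, -4462, 0, -2289,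
    0, -999, 0, -365, 0, -91, 0, -13, 0, 2],
  [0, 0, 2, 0, 0, 0, -8, 0, -57, 0, -161, 0, -395, 0, -735, 0, -1250, 0, -1824, 0, -2509, 0,
    -3045, 0, -3480, 0, -3511, 0, -3274, 0, -2522, 0, -1559, 0, -263, 0, 948, 0, 2141, 0, 2939, 0,
    3467, 0, 3504, 0, 3280, 0, 2748, 0, 2149, 0, 1501, 0, 966, 0, 540, 0, 268, 0, 104, 0, 30, 0,
    5, 0, 1],
  [0, 0, 0, -3, 0, -34, 0, -168, 0, -556, 0, -1425, 0, -3055, 0, -5725, 0, -9655, 0, -14896, 0,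
    -21281, 0, -28384, 0, -35549, 0, -41969, 0, -46847, 0, -49521, 0, -49609, 0, -47099, 0,
    -42335, 0, -35950, 0, -28755, 0, -21566, 0, -15057, 0, -9694, 0, -5667, 0, -2935, 0, -1283, 0,
    -427, 0, -68, 0, 28, 0, 27, 0, 11, 0, 1],
  [0, 0, 1, 0, -4, 0, -17, 0, -31, 0, 3, 0, 198, 0, 776, 0, 1977, 0, 4152, 0, 7486, 0, 12220, 0,
    18164, 0, 25137, 0, 32379, 0, 39336, 0, 44952, 0, 48716, 0, 49881, 0, 48535, 0, 44623, 0,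
    38930, 0, 31973, 0, 24790, 0, 17935, 0, 12124, 0, 7506, 0, 4248, 0, 2120, 0, 921, 0, 318, 0,
    84, 0, 11, 0, 2],
  [0, 0, 0, -6, 0, -45, 0, -199, 0, -628, 0, -1549, 0, -3245, 0, -5975, 0, -9955, 0, -15196, 0,
    -21538, 0, -28532, 0, -35546, 0, -41778, 0, -46476, 0, -48999, 0, -49011, 0, -46500, 0,
    -41812, 0, -35579, 0, -28565, 0, -21562, 0, -15204, 0, -9951, 0, -5967, 0, -3235, 0, -1534, 0,
    -616, 0, -193, 0, -45, 0, -4, 0, 0, 0, 0, 0, -1],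
  [0, 0, 0, 0, -10, 0, -34, 0, -83, 0, -89, 0, 39, 0, 559, 0, 1693, 0, 3853, 0, 7195, 0, 12014, 0,
    18079, 0, 25234, 0, 32657, 0, 39791, 0, 45517, 0, 49326, 0, 50456, 0, 48987, 0, 44911, 0,
    39022, 0, 31904, 0, 24576, 0, 17656, 0, 11811, 0, 7232, 0, 4023, 0, 1965, 0, 821, 0, 271, 0,
    63, 0, 6, 0, 1],
  [0, 0, 0, -4, 0, -22, 0, -90, 0, -236, 0, -515, 0, -918, 0, -1487, 0, -2107, 0, -2785, 0, -3284,
    0, -3615, 0, -3509, 0, -3095, 0, -2172, 0, -1075, 0, 298, 0, 1515, 0, 2641, 0, 3297, 0, 3663,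
    0, 3522, 0, 3156, 0, 2513, 0, 1868, 0, 1214, 0, 724, 0, 351, 0, 139, 0, 28, 0, -4, 0, -8, 0,
    -2, 0, -1],
  [0, 0, 0, 0, -1, 0, 17, 0, 136, 0, 561, 0, 1626, 0, 3833, 0, 7710, 0, 13818, 0, 22392, 0, 33510,
    0, 46554, 0, 60686, 0, 74345, 0, 86170, 0, 94452, 0, 98309, 0, 96965, 0, 90850, 0, 80564, 0,
    67686, 0, 53542, 0, 39854, 0, 27638, 0, 17799, 0, 10449, 0, 5539, 0, 2547, 0, 992, 0, 291, 0,
    57, 0, 1],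
  [0, 0, 0, -2, 0, -5, 0, -9, 0, 7, 0, 70, 0, 231, 0, 513, 0, 963, 0, 1517, 0, 2208, 0, 2836, 0,
    3398, 0, 3616, 0, 3564, 0, 2988, 0, 2143, 0, 889, 0, -370, 0, -1692, 0, -2655, 0, -3384, 0,
    -3590, 0, -3508, 0, -3038, 0, -2464, 0, -1776, 0, -1193, 0, -690, 0, -361, 0, -148, 0, -49, 0,
    -7, 0, -2],
  [0, 0, 0, 0, 1, 0, 25, 0, 138, 0, 489, 0, 1297, 0, 2864, 0, 5467, 0, 9355, 0, 14583, 0, 21022,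
    0, 28228, 0, 35557, 0, 42163, 0, 47228, 0, 50052, 0, 50225, 0, 47709, 0, 42856, 0, 36328, 0,
    28940, 0, 21563, 0, 14894, 0, 9431, 0, 5356, 0, 2636, 0, 1026, 0, 240, 0, -54, 0, -94, 0, -57,
    0, -19, 0, -3],
  [0, 0, 0, -1, 0, 0, 0, -3, 0, -13, 0, -101, 0, -351, 0, -1003, 0, -2254, 0, -4471, 0, -7774, 0,
    -12442, 0, -18240, 0, -25048, 0, -32089, 0, -38875, 0, -44366, 0, -48094, 0, -49305, 0,
    -48071, 0, -44343, 0, -38836, 0, -32065, 0, -25004, 0, -18235, 0, -12429, 0, -7793, 0, -4467,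
    0, -2277, 0, -1011, 0, -367, 0, -100, 0, -16, 0, -2],
  [0, 0, 0, 0, 4, 0, 36, 0, 171, 0, 558, 0, 1426, 0, 3055, 0, 5722, 0, 9649, 0, 14889, 0, 21273,
    0, 28377, 0, 35545, 0, 41970, 0, 46852, 0, 49530, 0, 49621, 0, 47110, 0, 42343, 0, 35955, 0,
    28757, 0, 21561, 0, 15049, 0, 9686, 0, 5660, 0, 2929, 0, 1281, 0, 426, 0, 70, 0, -25, 0, -24,
    0, -9, 0, -2, 0, 1],
  [0, 0, 0, 0, 0, 5, 0, 18, 0, 34, 0, -1, 0, -196, 0, -778, 0, -1980, 0, -4158, 0, -7495, 0,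
    -12228, 0, -18171, 0, -25140, 0, -32377, 0, -39327, 0, -44941, 0, -48704, 0, -49870, 0,
    -48526, 0, -44621, 0, -38933, 0, -31980, 0, -24798, 0, -17944, 0, -12130, 0, -7509, 0, -4250,
    0, -2118, 0, -919, 0, -315, 0, -83, 0, -10, 0, -1],
  [0, 0, 0, 0, 2, 0, 14, 0, 60, 0, 170, 0, 393, 0, 731, 0, 1230, 0, 1808, 0, 2474, 0, 3021, 0,
    3452, 0, 3506, 0, 3280, 0, 2550, 0, 1596, 0, 312, 0, -899, 0, -2110, 0, -2916, 0, -3469, 0,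
    -3514, 0, -3312, 0, -2772, 0, -2181, 0, -1514, 0, -982, 0, -542, 0, -267, 0, -95, 0, -26, 0,
    -1, 0, 0, 0, 1],
  [0, 0, 0, 0, 0, 2, 0, -3, 0, -38, 0, -193, 0, -618, 0, -1547, 0, -3242, 0, -5992, 0, -9967, 0,
    -15229, 0, -21568, 0, -28568, 0, -35561, 0, -41790, 0, -46463, 0, -48973, 0, -48970, 0,
    -46453, 0, -41774, 0, -35546, 0, -28552, 0, -21554, 0, -15224, 0, -9965, 0, -5993, 0, -3248,
    0, -1553, 0, -622, 0, -199, 0, -41, 0, -3, 0, 1],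
  [0, 0, 0, 0, 1, 0, 5, 0, 20, 0, 51, 0, 96, 0, 159, 0, 224, 0, 281, 0, 308, 0, 285, 0, 206, 0,
    76, 0, -99, 0, -293, 0, -460, 0, -573, 0, -614, 0, -570, 0, -449, 0, -278, 0, -87, 0, 84, 0,
    213, 0, 291, 0, 307, 0, 276, 0, 220, 0, 155, 0, 94, 0, 47, 0, 19, 0, 4, 0, 1],
  [0, 0, 0, 0, 0, -2, 0, -22, 0, -110, 0, -389, 0, -1033, 0, -2320, 0, -4490, 0, -7839, 0, -12416,
    0, -18253, 0, -24925, 0, -32040, 0, -38700, 0, -44306, 0, -47933, 0, -49313, 0, -48013, 0,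
    -44449, 0, -38869, 0, -32222, 0, -25071, 0, -18360, 0, -12452, 0, -7839, 0, -4444, 0, -2265,
    0, -965, 0, -339, 0, -72, 0, -4, 0, 7, 0, 2],
  [0, 0, 0, 0, 0, 0, -4, 0, -18, 0, -74, 0, -190, 0, -423, 0, -763, 0, -1266, 0, -1828, 0, -2479,
    0, -2993, 0, -3404, 0, -3430, 0, -3191, 0, -2460, 0, -1531, 0, -273, 0, 902, 0, 2072, 0, 2855,
    0, 3387, 0, 3436, 0, 3244, 0, 2731, 0, 2157, 0, 1520, 0, 999, 0, 567, 0, 290, 0, 118, 0, 40,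
    0, 8, 0, 1],
  [0, 0, 0, 0, 0, -1, 0, -8, 0, -41, 0, -120, 0, -293, 0, -571, 0, -1004, 0, -1527, 0, -2166, 0,
    -2734, 0, -3246, 0, -3438, 0, -3384, 0, -2844, 0, -2061, 0, -889, 0, 286, 0, 1542, 0, 2471, 0,
    3194, 0, 3428, 0, 3402, 0, 2990, 0, 2470, 0, 1821, 0, 1261, 0, 759, 0, 420, 0, 188, 0, 73, 0,
    18, 0, 4],
  [0, 0, 0, 0, 0, 0, 1, 0, 13, 0, 72, 0, 265, 0, 746, 0, 1737, 0, 3500, 0, 6288, 0, 10275, 0,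
    15479, 0, 21715, 0, 28555, 0, 35367, 0, 41405, 0, 45937, 0, 48368, 0, 48368, 0, 45937, 0,
    41405, 0, 35367, 0, 28555, 0, 21715, 0, 15479, 0, 10275, 0, 6288, 0, 3500, 0, 1737, 0, 746, 0,
    265, 0, 72, 0, 13, 0, 1]]

/-- The numerator over the denominator `∏ (1 - x * y ^ (-p))`, as a polynomial in `x, y⁻¹`. -/
def negNumerator : List (List ℤ) :=
  (subCoeffs₂ posNumerator
    ([1, 3, 5, 7, 9].foldr mulOneSub [posNumerator.headD []])).tail

/-- The common denominator of the two partial fraction numerators. -/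
def commonDenominator : List ℤ :=
  [2, 2, 4, 6, 8, 10, 12, 14, 16].foldr mulOneSubPow [1]

/-- The numerator of the Poincaré series of the covariants of the binary 9-form. -/
def poincareNumerator : List ℤ :=
  [1, 0, 3, 10, 23, 49, 93, 172, 289, 457, 701, 1036, 1477, 2023, 2720, 3568, 4573, 5702, 7013,
    8466, 10043, 11672, 13400, 15155, 16880, 18487, 20013, 21392, 22539, 23398, 24013, 24355,
    24355, 24013, 23398, 22539, 21392, 20013, 18487, 16880, 15155, 13400, 11672, 10043, 8466,
    7013, 5702, 4573, 3568, 2720, 2023, 1477, 1036, 701, 457, 289, 172, 93, 49, 23, 10, 3, 0, 1]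

theorem partialFraction_check :
    (subCoeffs₂ (subCoeffs₂ (List.replicate 25 [] ++ [commonDenominator])
      ([1, 3, 5, 7, 9].foldr mulPowSub posNumerator))
      ([1, 3, 5, 7, 9].foldr mulOneSub negNumerator.reverse)).all
        (fun l => l.all (fun c => decide (c = 0))) = true := by
  decide +kernel

theorem length_negNumerator : negNumerator.length = 25 := by
  decide +kernel

theorem poincareNumerator_check :
    (subCoeffs (subCoeffs (posNumerator.headD []) ((negNumerator.headD []).map Neg.neg))
      (subCoeffs poincareNumerator (0 :: poincareNumerator.map Neg.neg))).all
        (fun c => decide (c = 0)) = true := by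
  decide +kernel

section Evaluation

variable {R : Type*} [CommRing R] (x y : R)

@[simp] theorem evalCoeffs_nil : evalCoeffs x [] = 0 := rfl

@[simp] theorem evalCoeffs_cons (c : ℤ) (l : List ℤ) :
    evalCoeffs x (c :: l) = c + x * evalCoeffs x l := rfl

@[simp] theorem evalCoeffs₂_nil : evalCoeffs₂ x y [] = 0 := rfl

@[simp] theorem evalCoeffs₂_cons (c : List ℤ) (l : List (List ℤ)) :
    evalCoeffs₂ x y (c :: l) = evalCoeffs x c + y * evalCoeffs₂ x y l := rfl

theorem evalCoeffs_map_neg (l : List ℤ) :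
    evalCoeffs x (l.map Neg.neg) = -evalCoeffs x l := by
  induction l with
  | nil => simp
  | cons c l ih => simp [ih]; ring

theorem evalCoeffs₂_map_neg (l : List (List ℤ)) :
    evalCoeffs₂ x y (l.map (List.map Neg.neg)) = -evalCoeffs₂ x y l := by
  induction l with
  | nil => simp
  | cons c l ih => simp [ih, evalCoeffs_map_neg]; ring

theorem evalCoeffs_subCoeffs (l m : List ℤ) :
    evalCoeffs x (subCoeffs l m) = evalCoeffs x l - evalCoeffs x m := by
  induction l generalizing m with
  | nil => simp [subCoeffs, evalCoeffs_map_neg]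
  | cons a l ih =>
    cases m with
    | nil => simp [subCoeffs]
    | cons b m => simp [subCoeffs, ih]; ring

theorem evalCoeffs₂_subCoeffs₂ (l m : List (List ℤ)) :
    evalCoeffs₂ x y (subCoeffs₂ l m) = evalCoeffs₂ x y l - evalCoeffs₂ x y m := by
  induction l generalizing m with
  | nil => simp [subCoeffs₂, evalCoeffs₂_map_neg]
  | cons a l ih =>
    cases m with
    | nil => simp [subCoeffs₂]
    | cons b m => simp [subCoeffs₂, ih, evalCoeffs_subCoeffs]; ring

theorem evalCoeffs_replicate_append (e : ℕ) (l : List ℤ) :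
    evalCoeffs x (List.replicate e 0 ++ l) = x ^ e * evalCoeffs x l := by
  induction e with
  | zero => simp
  | succ e ih => simp [List.replicate_succ, ih]; ring

theorem evalCoeffs₂_replicate_append (e : ℕ) (l : List (List ℤ)) :
    evalCoeffs₂ x y (List.replicate e [] ++ l) = y ^ e * evalCoeffs₂ x y l := by
  induction e with
  | zero => simp
  | succ e ih => simp [List.replicate_succ, ih]; ring

theorem evalCoeffs₂_map_cons (l : List (List ℤ)) :
    evalCoeffs₂ x y (l.map (List.cons 0)) = x * evalCoeffs₂ x y l := by
  induction l with
  | nil => simp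
  | cons c l ih => simp [ih]; ring

theorem evalCoeffs_mulOneSubPow (e : ℕ) (l : List ℤ) :
    evalCoeffs x (mulOneSubPow e l) = (1 - x ^ e) * evalCoeffs x l := by
  rw [mulOneSubPow, evalCoeffs_subCoeffs, evalCoeffs_replicate_append]; ring

theorem evalCoeffs₂_mulOneSub (p : ℕ) (l : List (List ℤ)) :
    evalCoeffs₂ x y (mulOneSub p l) = (1 - x * y ^ p) * evalCoeffs₂ x y l := by
  rw [mulOneSub, evalCoeffs₂_subCoeffs₂, evalCoeffs₂_replicate_append, evalCoeffs₂_map_cons]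
  ring

theorem evalCoeffs₂_mulPowSub (q : ℕ) (l : List (List ℤ)) :
    evalCoeffs₂ x y (mulPowSub q l) = (y ^ q - x) * evalCoeffs₂ x y l := by
  rw [mulPowSub, evalCoeffs₂_subCoeffs₂, evalCoeffs₂_replicate_append, evalCoeffs₂_map_cons]
  ring

theorem evalCoeffs_eq_zero {l : List ℤ} (h : l.all (fun c => decide (c = 0)) = true) :
    evalCoeffs x l = 0 := by
  induction l with
  | nil => simp
  | cons c l ih =>
    simp only [List.all_cons, Bool.and_eq_true, decide_eq_true_eq] at h
    simp [h.1, ih h.2]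

theorem evalCoeffs₂_eq_zero {l : List (List ℤ)}
    (h : l.all (fun l => l.all (fun c => decide (c = 0))) = true) :
    evalCoeffs₂ x y l = 0 := by
  induction l with
  | nil => simp
  | cons c l ih =>
    rw [List.all_cons, Bool.and_eq_true] at h
    simp [evalCoeffs_eq_zero x h.1, ih h.2]

theorem evalCoeffs₂_append (l m : List (List ℤ)) :
    evalCoeffs₂ x y (l ++ m) = evalCoeffs₂ x y l + y ^ l.length * evalCoeffs₂ x y m := by
  induction l with
  | nil => simp
  | cons c l ih => simp [ih]; ring

theorem evalCoeffs₂_reverse {s : R} (hs : y * s = 1) (l : List (List ℤ)) :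
    y * evalCoeffs₂ x y l.reverse = y ^ l.length * evalCoeffs₂ x s l := by
  induction l with
  | nil => simp
  | cons c l ih =>
    simp only [List.reverse_cons, evalCoeffs₂_append, List.length_reverse, evalCoeffs₂_cons,
      evalCoeffs₂_nil, List.length_cons]
    linear_combination ih - y ^ l.length * evalCoeffs₂ x s l * hs

theorem evalCoeffs₂_zero_right (l : List (List ℤ)) :
    evalCoeffs₂ x 0 l = evalCoeffs x (l.headD []) := by
  cases l <;> simp

theorem map_evalCoeffs {S : Type*} [CommRing S] (f : R →+* S) (l : List ℤ) :
    f (evalCoeffs x l) = evalCoeffs (f x) l := by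
  induction l with
  | nil => simp
  | cons c l ih => simp [ih]

theorem map_evalCoeffs₂ {S : Type*} [CommRing S] (f : R →+* S) (l : List (List ℤ)) :
    f (evalCoeffs₂ x y l) = evalCoeffs₂ (f x) (f y) l := by
  induction l with
  | nil => simp
  | cons c l ih => simp [ih, map_evalCoeffs]

theorem evalCoeffs_commonDenominator :
    evalCoeffs x commonDenominator = (1 - x ^ 2) * ((1 - x ^ 2) * (1 - x ^ 4) * (1 - x ^ 6) *
      (1 - x ^ 8) * (1 - x ^ 10) * (1 - x ^ 12) * (1 - x ^ 14) * (1 - x ^ 16)) := by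
  simp only [commonDenominator, List.foldr_cons, List.foldr_nil, evalCoeffs_mulOneSubPow,
    evalCoeffs_cons, evalCoeffs_nil]
  push_cast
  ring

/-- Partial fraction decomposition with respect to `y` of
`∏ 1 / ((1 - x * y ^ p) * (1 - x * y ^ (-p)))`, for `p = 1, 3, 5, 7, 9`; here `s = y⁻¹`. -/
theorem partialFraction {s : R} (hs : y * s = 1) (g h : ℕ → R)
    (hg : ∀ p, (1 - x * y ^ p) * g p = 1) (hh : ∀ p, (1 - x * s ^ p) * h p = 1) :
    evalCoeffs x commonDenominator *
        ((g 1 * g 3 * g 5 * g 7 * g 9) * (h 1 * h 3 * h 5 * h 7 * h 9)) =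
      evalCoeffs₂ x y posNumerator * (g 1 * g 3 * g 5 * g 7 * g 9) +
        s * evalCoeffs₂ x s negNumerator * (h 1 * h 3 * h 5 * h 7 * h 9) := by
  have key := evalCoeffs₂_eq_zero x y partialFraction_check
  have hrev := evalCoeffs₂_reverse x y hs negNumerator
  rw [length_negNumerator] at hrev
  simp only [evalCoeffs₂_subCoeffs₂, evalCoeffs₂_replicate_append, List.foldr_cons,
    List.foldr_nil, evalCoeffs₂_mulOneSub, evalCoeffs₂_mulPowSub, evalCoeffs₂_cons,
    evalCoeffs₂_nil, mul_zero, add_zero] at key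
  generalize evalCoeffs₂ x y negNumerator.reverse = B' at key hrev
  generalize evalCoeffs₂ x y posNumerator = A at key ⊢
  generalize evalCoeffs₂ x s negNumerator = B at hrev ⊢
  generalize evalCoeffs x commonDenominator = D at key ⊢
  have hB : B' = y ^ 25 * (s * B) := by
    linear_combination s * hrev - B' * hs
  have hpow (q : ℕ) : y ^ q - x = y ^ q * (1 - x * s ^ q) := by
    have : y ^ q * s ^ q = 1 := by rw [← mul_pow, hs, one_pow]
    linear_combination x * this
  have hunit : s ^ 25 * y ^ 25 = 1 := by rw [← mul_pow, mul_comm, hs, one_pow]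
  rw [hB] at key
  simp only [hpow] at key
  have hP : ((1 - x * y ^ 1) * (1 - x * y ^ 3) * (1 - x * y ^ 5) * (1 - x * y ^ 7) *
      (1 - x * y ^ 9)) * (g 1 * g 3 * g 5 * g 7 * g 9) = 1 := by
    rw [← one_mul (1 : R)]
    calc _ = ((1 - x * y ^ 1) * g 1) * ((1 - x * y ^ 3) * g 3) * ((1 - x * y ^ 5) * g 5) *
          ((1 - x * y ^ 7) * g 7) * ((1 - x * y ^ 9) * g 9) := by ac_rfl
      _ = _ := by simp only [hg, mul_one]
  have hN : ((1 - x * s ^ 1) * (1 - x * s ^ 3) * (1 - x * s ^ 5) * (1 - x * s ^ 7) *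
      (1 - x * s ^ 9)) * (h 1 * h 3 * h 5 * h 7 * h 9) = 1 := by
    rw [← one_mul (1 : R)]
    calc _ = ((1 - x * s ^ 1) * h 1) * ((1 - x * s ^ 3) * h 3) * ((1 - x * s ^ 5) * h 5) *
          ((1 - x * s ^ 7) * h 7) * ((1 - x * s ^ 9) * h 9) := by ac_rfl
      _ = _ := by simp only [hh, mul_one]
  generalize g 1 * g 3 * g 5 * g 7 * g 9 = G at hP ⊢
  generalize h 1 * h 3 * h 5 * h 7 * h 9 = H at hN ⊢
  have key' : y ^ 25 * (D - A * ((1 - x * s ^ 1) * (1 - x * s ^ 3) * (1 - x * s ^ 5) *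
      (1 - x * s ^ 7) * (1 - x * s ^ 9)) - s * B * ((1 - x * y ^ 1) * (1 - x * y ^ 3) *
      (1 - x * y ^ 5) * (1 - x * y ^ 7) * (1 - x * y ^ 9))) = 0 := by
    rw [← key]
    generalize 1 - x * s ^ 1 = n1
    generalize 1 - x * s ^ 3 = n3
    generalize 1 - x * s ^ 5 = n5
    generalize 1 - x * s ^ 7 = n7
    generalize 1 - x * s ^ 9 = n9
    generalize 1 - x * y ^ 1 = p1
    generalize 1 - x * y ^ 3 = p3
    generalize 1 - x * y ^ 5 = p5
    generalize 1 - x * y ^ 7 = p7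
    generalize 1 - x * y ^ 9 = p9
    ring
  generalize (1 - x * s ^ 1) * (1 - x * s ^ 3) * (1 - x * s ^ 5) * (1 - x * s ^ 7) *
    (1 - x * s ^ 9) = N at hN key'
  generalize (1 - x * y ^ 1) * (1 - x * y ^ 3) * (1 - x * y ^ 5) * (1 - x * y ^ 7) *
    (1 - x * y ^ 9) = P at hP key'
  generalize y ^ 25 = Y at hunit key'
  generalize s ^ 25 = S at hunit key'
  have hD : D - A * N - s * B * P = 0 := by
    linear_combination S * key' - (D - A * N - s * B * P) * hunit
  linear_combination (G * H) * hD + A * G * hN + s * B * H * hP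

theorem evalCoeffs_poincareNumerator :
    evalCoeffs x (posNumerator.headD []) + evalCoeffs x (negNumerator.headD []) =
      (1 + x) * evalCoeffs x poincareNumerator := by
  have h := evalCoeffs_eq_zero x poincareNumerator_check
  simp only [evalCoeffs_subCoeffs, evalCoeffs_map_neg, evalCoeffs_cons, Int.cast_zero] at h
  linear_combination h

end Evaluation

section LaurentSeries

open LaurentPolynomial

/-- The geometric series `∑ zⁿ T^(w * n)`, inverse to `1 - z T^w`. -/
def geomSeries (w : ℤ) : PowerSeries ℤ[T;T⁻¹] :=
  PowerSeries.mk fun n => T (w * n)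

/-- The power series of the coefficients of `T ^ k`. -/
def laurentCoeff (k : ℤ) (f : PowerSeries ℤ[T;T⁻¹]) : PowerSeries ℤ :=
  PowerSeries.mk fun n => (PowerSeries.coeff n f).coeff k

theorem one_sub_mul_geomSeries (w : ℤ) :
    (1 - PowerSeries.X * PowerSeries.C (T w)) * geomSeries w = 1 := by
  ext1 n
  rw [sub_mul, one_mul, mul_assoc, map_sub]
  cases n with
  | zero => simp [geomSeries]
  | succ n =>
    rw [PowerSeries.coeff_succ_X_mul, PowerSeries.coeff_C_mul, geomSeries, PowerSeries.coeff_mk,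
      PowerSeries.coeff_mk, ← T_add, PowerSeries.coeff_one, if_neg n.succ_ne_zero, sub_eq_zero]
    congr 1
    push_cast
    ring

theorem laurentCoeff_add (k : ℤ) (f g : PowerSeries ℤ[T;T⁻¹]) :
    laurentCoeff k (f + g) = laurentCoeff k f + laurentCoeff k g := by
  ext n
  simp [laurentCoeff]

theorem laurentCoeff_sub (k : ℤ) (f g : PowerSeries ℤ[T;T⁻¹]) :
    laurentCoeff k (f - g) = laurentCoeff k f - laurentCoeff k g := by
  ext n
  simp [laurentCoeff]

theorem laurentCoeff_X_pow_mul (k : ℤ) (e : ℕ) (f : PowerSeries ℤ[T;T⁻¹]) :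
    laurentCoeff k (PowerSeries.X ^ e * f) = PowerSeries.X ^ e * laurentCoeff k f := by
  ext n
  simp only [laurentCoeff, PowerSeries.coeff_X_pow_mul', PowerSeries.coeff_mk]
  split_ifs <;> simp

theorem laurentCoeff_one_sub_X_pow_mul (k : ℤ) (e : ℕ) (f : PowerSeries ℤ[T;T⁻¹]) :
    laurentCoeff k ((1 - PowerSeries.X ^ e) * f) =
      (1 - PowerSeries.X ^ e) * laurentCoeff k f := by
  rw [sub_mul, sub_mul, laurentCoeff_sub, laurentCoeff_X_pow_mul, one_mul, one_mul]

theorem laurentCoeff_C_T_mul (j k : ℤ) (f : PowerSeries ℤ[T;T⁻¹]) :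
    laurentCoeff k (PowerSeries.C (T j) * f) = laurentCoeff (k - j) f := by
  ext n
  rw [laurentCoeff, laurentCoeff, PowerSeries.coeff_mk, PowerSeries.coeff_mk,
    PowerSeries.coeff_C_mul]
  rw [T, AddMonoidAlgebra.coeff_single_mul_apply, one_mul, neg_add_eq_sub]

theorem coeff_toLaurent_natCast (p : Polynomial ℤ) (n : ℕ) :
    (Polynomial.toLaurent p).coeff (n : ℤ) = p.coeff n := by
  rw [Polynomial.toLaurent_apply]
  simp [Polynomial.coeff, Finsupp.mapDomain_apply Nat.cast_injective]

theorem coeff_toLaurent_of_neg (p : Polynomial ℤ) {k : ℤ} (hk : k < 0) :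
    (Polynomial.toLaurent p).coeff k = 0 := by
  rw [Polynomial.toLaurent_apply]
  simp only [AddMonoidAlgebra.coeff_mapDomain]
  apply Finsupp.mapDomain_of_notMem_range
  rintro ⟨n, rfl⟩
  omega

theorem laurentCoeff_map_toLaurent_zero (f : PowerSeries (Polynomial ℤ)) :
    laurentCoeff 0 (PowerSeries.map Polynomial.toLaurent f) =
      PowerSeries.map Polynomial.constantCoeff f := by
  ext n
  simpa [laurentCoeff] using coeff_toLaurent_natCast (PowerSeries.coeff n f) 0

theorem laurentCoeff_map_toLaurent_neg (f : PowerSeries (Polynomial ℤ)) {k : ℤ} (hk : k < 0) :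
    laurentCoeff k (PowerSeries.map Polynomial.toLaurent f) = 0 := by
  ext n
  simpa [laurentCoeff] using coeff_toLaurent_of_neg (PowerSeries.coeff n f) hk

theorem laurentCoeff_map_invert (k : ℤ) (f : PowerSeries ℤ[T;T⁻¹]) :
    laurentCoeff k (PowerSeries.map (invert (R := ℤ) : ℤ[T;T⁻¹] →+* ℤ[T;T⁻¹]) f) =
      laurentCoeff (-k) f := by
  ext n
  simp [laurentCoeff, invert_apply]

/-- The geometric series `∑ zⁿ t^(p * n)` over the polynomial ring. -/
def polyGeomSeries (p : ℕ) : PowerSeries (Polynomial ℤ) :=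
  PowerSeries.mk fun n => Polynomial.X ^ (p * n)

theorem map_toLaurent_polyGeomSeries (p : ℕ) :
    PowerSeries.map Polynomial.toLaurent (polyGeomSeries p) = geomSeries p := by
  ext1 n
  simp [polyGeomSeries, geomSeries]

theorem map_invert_geomSeries (w : ℤ) :
    PowerSeries.map (invert (R := ℤ) : ℤ[T;T⁻¹] →+* ℤ[T;T⁻¹]) (geomSeries w) =
      geomSeries (-w) := by
  ext1 n
  simp [geomSeries]

theorem map_constantCoeff_polyGeomSeries {p : ℕ} (hp : p ≠ 0) :
    PowerSeries.map Polynomial.constantCoeff (polyGeomSeries p) = 1 := by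
  ext n
  simp [polyGeomSeries, PowerSeries.coeff_one, Polynomial.coeff_X_pow, hp, eq_comm]

/-- The numerator `l` over the denominator `∏ (1 - z t^p)`, for `p = 1, 3, 5, 7, 9`. -/
def polySeries (l : List (List ℤ)) : PowerSeries (Polynomial ℤ) :=
  evalCoeffs₂ PowerSeries.X (PowerSeries.C Polynomial.X) l *
    (polyGeomSeries 1 * polyGeomSeries 3 * polyGeomSeries 5 * polyGeomSeries 7 *
      polyGeomSeries 9)

theorem map_toLaurent_polySeries (l : List (List ℤ)) :
    PowerSeries.map Polynomial.toLaurent (polySeries l) =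
      evalCoeffs₂ PowerSeries.X (PowerSeries.C (T 1)) l *
        (geomSeries 1 * geomSeries 3 * geomSeries 5 * geomSeries 7 * geomSeries 9) := by
  simp [polySeries, map_evalCoeffs₂, map_toLaurent_polyGeomSeries]

theorem map_invert_map_toLaurent_polySeries (l : List (List ℤ)) :
    PowerSeries.map (invert (R := ℤ) : ℤ[T;T⁻¹] →+* ℤ[T;T⁻¹])
        (PowerSeries.map Polynomial.toLaurent (polySeries l)) =
      evalCoeffs₂ PowerSeries.X (PowerSeries.C (T (-1))) l *
        (geomSeries (-1) * geomSeries (-3) * geomSeries (-5) * geomSeries (-7) *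
          geomSeries (-9)) := by
  rw [map_toLaurent_polySeries]
  simp [map_evalCoeffs₂, map_invert_geomSeries]

theorem map_constantCoeff_polySeries (l : List (List ℤ)) :
    PowerSeries.map Polynomial.constantCoeff (polySeries l) =
      evalCoeffs PowerSeries.X (l.headD []) := by
  simp [polySeries, map_evalCoeffs₂, map_constantCoeff_polyGeomSeries, evalCoeffs₂_zero_right]

/-- The generating series of the monomials in `x_0, …, x_9`, where `z` marks the degree and
`x_i` has `T`-weight `2 * i - 9`. -/
def characterSeries : PowerSeries ℤ[T;T⁻¹] :=
  ∏ i : Fin 10, geomSeries (2 * (i : ℤ) - 9)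

theorem characterSeries_eq :
    characterSeries =
      (geomSeries 1 * geomSeries 3 * geomSeries 5 * geomSeries 7 * geomSeries 9) *
        (geomSeries (-1) * geomSeries (-3) * geomSeries (-5) * geomSeries (-7) *
          geomSeries (-9)) := by
  simp only [characterSeries, Fin.prod_univ_succ, Fin.prod_univ_zero]
  norm_num [Fin.val_succ]
  ring

theorem commonDenominator_mul_characterSeries :
    evalCoeffs PowerSeries.X commonDenominator * characterSeries =
      PowerSeries.map Polynomial.toLaurent (polySeries posNumerator) +
        PowerSeries.C (T (-1)) *
          PowerSeries.map (invert (R := ℤ) : ℤ[T;T⁻¹] →+* ℤ[T;T⁻¹])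
            (PowerSeries.map Polynomial.toLaurent (polySeries negNumerator)) := by
  have hs : (PowerSeries.C (T 1 : ℤ[T;T⁻¹]) : PowerSeries ℤ[T;T⁻¹]) *
      PowerSeries.C (T (-1)) = 1 := by
    rw [← map_mul, ← T_add]
    simp
  have h := partialFraction PowerSeries.X _ hs (fun p => geomSeries p) (fun p => geomSeries (-p))
    (fun p => by rw [← map_pow, T_pow, mul_one, one_sub_mul_geomSeries])
    (fun p => by rw [← map_pow, T_pow, mul_neg_one, one_sub_mul_geomSeries])
  rw [characterSeries_eq, map_toLaurent_polySeries, map_invert_map_toLaurent_polySeries,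
    ← mul_assoc (PowerSeries.C _)]
  exact_mod_cast h

theorem laurentCoeff_commonDenominator_mul (k : ℤ) (f : PowerSeries ℤ[T;T⁻¹]) :
    laurentCoeff k (evalCoeffs PowerSeries.X commonDenominator * f) =
      evalCoeffs PowerSeries.X commonDenominator * laurentCoeff k f := by
  simp only [evalCoeffs_commonDenominator, mul_assoc, laurentCoeff_one_sub_X_pow_mul]

theorem commonDenominator_mul_laurentCoeff :
    evalCoeffs PowerSeries.X commonDenominator *
        (laurentCoeff 0 characterSeries + laurentCoeff (-1) characterSeries) =
      (1 + PowerSeries.X) * evalCoeffs PowerSeries.X poincareNumerator := by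
  rw [mul_add, ← laurentCoeff_commonDenominator_mul, ← laurentCoeff_commonDenominator_mul,
    commonDenominator_mul_characterSeries, laurentCoeff_add, laurentCoeff_add,
    laurentCoeff_C_T_mul, laurentCoeff_C_T_mul, laurentCoeff_map_invert, laurentCoeff_map_invert,
    laurentCoeff_map_toLaurent_zero, map_constantCoeff_polySeries,
    laurentCoeff_map_toLaurent_neg _ (by norm_num), laurentCoeff_map_toLaurent_neg _ (by norm_num),
    ← evalCoeffs_poincareNumerator]
  norm_num [laurentCoeff_map_toLaurent_zero, map_constantCoeff_polySeries]

theorem coeff_laurentCoeff_characterSeries (n : ℕ) (k : ℤ) :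
    PowerSeries.coeff n (laurentCoeff k characterSeries) =
      ((Finset.univ.finsuppAntidiag n).filter
        (fun a : Fin 10 →₀ ℕ => ∑ i : Fin 10, (2 * (i : ℤ) - 9) * a i = k)).card := by
  have hT (s : Finset (Fin 10)) (e : Fin 10 → ℤ) :
      ∏ i ∈ s, (T (e i) : ℤ[T;T⁻¹]) = T (∑ i ∈ s, e i) := by
    induction s using Finset.induction_on with
    | empty => simp
    | insert a s ha ih => rw [Finset.prod_insert ha, Finset.sum_insert ha, ih, T_add]
  simp only [laurentCoeff, characterSeries, PowerSeries.coeff_mk, PowerSeries.coeff_prod,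
    geomSeries, hT, AddMonoidAlgebra.coeff_sum, Finsupp.finsetSum_apply, T_apply,
    Finset.sum_boole]

end LaurentSeries

theorem PSeries_nine :
    PSeries 9 = PowerSeries.map (Int.castRingHom ℂ)
      (laurentCoeff 0 characterSeries + laurentCoeff (-1) characterSeries) := by
  ext n
  rw [PSeries, PowerSeries.coeff_mk, PowerSeries.coeff_map, map_add, map_add, finrank_Sn,
    coeff_laurentCoeff_characterSeries, coeff_laurentCoeff_characterSeries,
    map_natCast, map_natCast]
  push_cast
  rfl

theorem mul_PSeries_nine :
    ((1 - (PowerSeries.X : PowerSeries ℂ)) * (1 - PowerSeries.X ^ 2) * (1 - PowerSeries.X ^ 4) *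
      (1 - PowerSeries.X ^ 6) * (1 - PowerSeries.X ^ 8) * (1 - PowerSeries.X ^ 10) *
      (1 - PowerSeries.X ^ 12) * (1 - PowerSeries.X ^ 14) * (1 - PowerSeries.X ^ 16)) *
        PSeries 9 = evalCoeffs PowerSeries.X poincareNumerator := by
  have hX : (1 + PowerSeries.X : PowerSeries ℂ) ≠ 0 := by
    intro h
    simpa using congrArg PowerSeries.constantCoeff h
  have h := congrArg (PowerSeries.map (Int.castRingHom ℂ)) commonDenominator_mul_laurentCoeff
  rw [map_mul, map_mul, ← PSeries_nine, map_evalCoeffs, map_evalCoeffs, map_add, map_one,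
    PowerSeries.map_X, evalCoeffs_commonDenominator] at h
  refine mul_left_cancel₀ hX (Eq.trans ?_ h)
  ring

theorem evalCoeffs_poincareNumerator_eq {R : Type*} [CommRing R] (x : R) :
    evalCoeffs x poincareNumerator =
      1 + 3 * x ^ 2 + 10 * x ^ 3 + 23 * x ^ 4 + 49 * x ^ 5 + 93 * x ^ 6 + 172 * x ^ 7 +
      289 * x ^ 8 + 457 * x ^ 9 + 701 * x ^ 10 + 1036 * x ^ 11 + 1477 * x ^ 12 + 2023 * x ^ 13 +
      2720 * x ^ 14 + 3568 * x ^ 15 + 4573 * x ^ 16 + 5702 * x ^ 17 + 7013 * x ^ 18 +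
      8466 * x ^ 19 + 10043 * x ^ 20 + 11672 * x ^ 21 + 13400 * x ^ 22 + 15155 * x ^ 23 +
      16880 * x ^ 24 + 18487 * x ^ 25 + 20013 * x ^ 26 + 21392 * x ^ 27 + 22539 * x ^ 28 +
      23398 * x ^ 29 + 24013 * x ^ 30 + 24355 * x ^ 31 + 24355 * x ^ 32 + 24013 * x ^ 33 +
      23398 * x ^ 34 + 22539 * x ^ 35 + 21392 * x ^ 36 + 20013 * x ^ 37 + 18487 * x ^ 38 +
      16880 * x ^ 39 + 15155 * x ^ 40 + 13400 * x ^ 41 + 11672 * x ^ 42 + 10043 * x ^ 43 +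
      8466 * x ^ 44 + 7013 * x ^ 45 + 5702 * x ^ 46 + 4573 * x ^ 47 + 3568 * x ^ 48 +
      2720 * x ^ 49 + 2023 * x ^ 50 + 1477 * x ^ 51 + 1036 * x ^ 52 + 701 * x ^ 53 +
      457 * x ^ 54 + 289 * x ^ 55 + 172 * x ^ 56 + 93 * x ^ 57 + 49 * x ^ 58 + 23 * x ^ 59 +
      10 * x ^ 60 + 3 * x ^ 61 + x ^ 63 := by
  simp only [poincareNumerator, evalCoeffs_cons, evalCoeffs_nil]
  push_cast
  ring

/-- The Poincaré series of the algebra of covariants of the binary 9-form. -/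
theorem poincare_series_d9 :
    PSeries 9 = (1 + 3 * (PowerSeries.X : PowerSeries ℂ) ^ 2 + 10 * (PowerSeries.X : PowerSeries ℂ) ^ 3 + 23 * (PowerSeries.X : PowerSeries ℂ) ^ 4 + 49 * (PowerSeries.X : PowerSeries ℂ) ^ 5 + 93 * (PowerSeries.X : PowerSeries ℂ) ^ 6 + 172 * (PowerSeries.X : PowerSeries ℂ) ^ 7 + 289 * (PowerSeries.X : PowerSeries ℂ) ^ 8 + 457 * (PowerSeries.X : PowerSeries ℂ) ^ 9 + 701 * (PowerSeries.X : PowerSeries ℂ) ^ 10 + 1036 * (PowerSeries.X : PowerSeries ℂ) ^ 11 + 1477 * (PowerSeries.X : PowerSeries ℂ) ^ 12 + 2023 * (PowerSeries.X : PowerSeries ℂ) ^ 13 + 2720 * (PowerSeries.X : PowerSeries ℂ) ^ 14 + 3568 * (PowerSeries.X : PowerSeries ℂ) ^ 15 + 4573 * (PowerSeries.X : PowerSeries ℂ) ^ 16 + 5702 * (PowerSeries.X : PowerSeries ℂ) ^ 17 + 7013 * (PowerSeries.X : PowerSeries ℂ) ^ 18 + 8466 * (PowerSeries.X : PowerSeries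 ℂ) ^ 19 + 10043 * (PowerSeries.X : PowerSeries ℂ) ^ 20 + 11672 * (PowerSeries.X : PowerSeries ℂ) ^ 21 + 13400 * (PowerSeries.X : PowerSeries ℂ) ^ 22 + 15155 * (PowerSeries.X : PowerSeries ℂ) ^ 23 + 16880 * (PowerSeries.X : PowerSeries ℂ) ^ 24 + 18487 * (PowerSeries.X : PowerSeries ℂ) ^ 25 + 20013 * (PowerSeries.X : PowerSeries ℂ) ^ 26 + 21392 * (PowerSeries.X : PowerSeries ℂ) ^ 27 + 22539 * (PowerSeries.X : PowerSeries ℂ) ^ 28 + 23398 * (PowerSeries.X : PowerSeries ℂ) ^ 29 + 24013 * (PowerSeries.X : PowerSeries ℂ) ^ 30 + 24355 * (PowerSeries.X : PowerSeries ℂ) ^ 31 + 24355 * (PowerSeries.X : PowerSeries ℂ) ^ 32 + 24013 * (PowerSeries.X : PowerSeries ℂ) ^ 33 + 23398 * (PowerSeries.X : PowerSeries ℂ) ^ 34 + 22539 * (PowerSeries.X : PowerSeries ℂ) ^ 35 + 21392 * (PowerSeries.X : PowerSeries ℂ) ^ 36 + 20013 * (PowerSeries.X : PowerSeries ℂ)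 ^ 37 + 18487 * (PowerSeries.X : PowerSeries ℂ) ^ 38 + 16880 * (PowerSeries.X : PowerSeries ℂ) ^ 39 + 15155 * (PowerSeries.X : PowerSeries ℂ) ^ 40 + 13400 * (PowerSeries.X : PowerSeries ℂ) ^ 41 + 11672 * (PowerSeries.X : PowerSeries ℂ) ^ 42 + 10043 * (PowerSeries.X : PowerSeries ℂ) ^ 43 + 8466 * (PowerSeries.X : PowerSeries ℂ) ^ 44 + 7013 * (PowerSeries.X : PowerSeries ℂ) ^ 45 + 5702 * (PowerSeries.X : PowerSeries ℂ) ^ 46 + 4573 * (PowerSeries.X : PowerSeries ℂ) ^ 47 + 3568 * (PowerSeries.X : PowerSeries ℂ) ^ 48 + 2720 * (PowerSeries.X : PowerSeries ℂ) ^ 49 + 2023 * (PowerSeries.X : PowerSeries ℂ) ^ 50 + 1477 * (PowerSeries.X : PowerSeries ℂ) ^ 51 + 1036 * (PowerSeries.X : PowerSeries ℂ) ^ 52 + 701 * (PowerSeries.X : PowerSeries ℂ) ^ 53 + 457 * (PowerSeries.X : PowerSeries ℂ) ^ 54 + 289 * (PowerSeries.X : PowerSeries ℂ) ^ 55 + 172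 * (PowerSeries.X : PowerSeries ℂ) ^ 56 + 93 * (PowerSeries.X : PowerSeries ℂ) ^ 57 + 49 * (PowerSeries.X : PowerSeries ℂ) ^ 58 + 23 * (PowerSeries.X : PowerSeries ℂ) ^ 59 + 10 * (PowerSeries.X : PowerSeries ℂ) ^ 60 + 3 * (PowerSeries.X : PowerSeries ℂ) ^ 61 + (PowerSeries.X : PowerSeries ℂ) ^ 63) * ((1 - (PowerSeries.X : PowerSeries ℂ)) * (1 - (PowerSeries.X : PowerSeries ℂ) ^ 2) * (1 - (PowerSeries.X : PowerSeries ℂ) ^ 4) * (1 - (PowerSeries.X : PowerSeries ℂ) ^ 6) * (1 - (PowerSeries.X : PowerSeries ℂ) ^ 8) * (1 - (PowerSeries.X : PowerSeries ℂ) ^ 10) * (1 - (PowerSeries.X : PowerSeries ℂ) ^ 12) * (1 - (PowerSeries.X : PowerSeries ℂ) ^ 14) * (1 - (PowerSeries.X : PowerSeries ℂ) ^ 16))⁻¹ := by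
  rw [PowerSeries.eq_mul_inv_iff_mul_eq (by simp), mul_comm, mul_PSeries_nine,
    evalCoeffs_poincareNumerator_eq]

end
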